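/- arXiv:math/0407115 — 2 statements merged into one kernel-verified Lean document; each statement's English description precedes it below -/
import Mathlib

section
/- For all elements x, y of a commutative ring and every natural number n ≥ 1, x^n − y^n = (x − y) · Σ_{i=0}^{⌊(n−1)/2⌋} (−1)^i · C(n − i − 1, i) · (x + y)^(n − 2i − 1) · (xy)^i, where C(m, r) denotes the binomial coefficient. (The sum may equivalently be taken up to n − 1, since C(n − i − 1, i) = 0 once 2i > n − 1.) -/
/-- Pascal's rule for the terms `C(m-i, i) s^(m-2i) qⁱ` of the bivariate Fibonacci polynomials. -/
theorem choose_mul_pow_succ_eq {R : Type*} [CommRing R] (s q : R) (m i : ℕ) :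
    ((m + 2 - (i + 1)).choose (i + 1) : R) * s ^ (m + 2 - 2 * (i + 1)) * q ^ (i + 1) =
      s * (((m + 1 - (i + 1)).choose (i + 1) : R) * s ^ (m + 1 - 2 * (i + 1)) * q ^ (i + 1)) +
        q * (((m - i).choose i : R) * s ^ (m - 2 * i) * q ^ i) := by
  rcases Nat.lt_or_ge m i with h | h
  · rw [Nat.choose_eq_zero_of_lt (show m + 2 - (i + 1) < i + 1 by omega),
      Nat.choose_eq_zero_of_lt (show m + 1 - (i + 1) < i + 1 by omega),
      Nat.choose_eq_zero_of_lt (show m - i < i by omega)]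
    simp
  · rw [show m + 2 - (i + 1) = m - i + 1 by omega, show m + 1 - (i + 1) = m - i by omega,
      show m + 2 - 2 * (i + 1) = m - 2 * i by omega, Nat.choose_succ_succ]
    rcases Nat.lt_or_ge (2 * i) m with h' | h'
    · rw [show m - 2 * i = m + 1 - 2 * (i + 1) + 1 by omega]
      push_cast
      ring
    · rw [Nat.choose_eq_zero_of_lt (show m - i < i + 1 by omega)]
      push_cast
      ring

theorem sub_mul_sum_choose_eq_pow_sub_pow {R : Type*} [CommRing R] (x y : R) (m N : ℕ)
    (hN : m < 2 * N) :
    (x - y) * ∑ i ∈ Finset.range N,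
        ((m - i).choose i : R) * (x + y) ^ (m - 2 * i) * (-(x * y)) ^ i =
      x ^ (m + 1) - y ^ (m + 1) := by
  induction m using Nat.twoStepInduction generalizing N with
  | zero =>
    obtain ⟨N, rfl⟩ : ∃ k, N = k + 1 := ⟨N - 1, by omega⟩
    simp [Finset.sum_range_succ']
  | one =>
    obtain ⟨N, rfl⟩ : ∃ k, N = k + 1 := ⟨N - 1, by omega⟩
    simp [Finset.sum_range_succ']
    ring
  | more m ih₀ ih₁ =>
    obtain ⟨N, rfl⟩ : ∃ k, N = k + 1 := ⟨N - 1, by omega⟩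
    have h₀ := ih₀ N (by omega)
    have h₁ := ih₁ (N + 1) (by omega)
    rw [Finset.sum_range_succ'] at h₁ ⊢
    simp only [choose_mul_pow_succ_eq, Finset.sum_add_distrib, ← Finset.mul_sum]
    simp only [Nat.choose_zero_right, Nat.sub_zero, mul_zero, pow_zero] at h₁ ⊢
    linear_combination (x + y) * h₁ - x * y * h₀

/-- The identity `xⁿ - yⁿ = (x - y) ∑ᵢ (-1)ⁱ C(n-i-1, i) (x+y)^(n-2i-1) (xy)ⁱ`
in any commutative ring. -/
theorem pow_sub_pow_binomial_identity {R : Type*} [CommRing R] (x y : R)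
    (n : ℕ) (hn : 1 ≤ n) :
    x ^ n - y ^ n =
      (x - y) *
        ∑ i ∈ Finset.range ((n - 1) / 2 + 1),
          (-1 : R) ^ i * ((n - i - 1).choose i : R) *
            (x + y) ^ (n - 2 * i - 1) * (x * y) ^ i := by
  obtain ⟨m, rfl⟩ : ∃ k, n = k + 1 := ⟨n - 1, by omega⟩
  rw [← sub_mul_sum_choose_eq_pow_sub_pow x y m ((m + 1 - 1) / 2 + 1) (by omega)]
  congr 1
  refine Finset.sum_congr rfl fun i _ => ?_
  rw [show m + 1 - i - 1 = m - i by omega, show m + 1 - 2 * i - 1 = m - 2 * i by omega,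
    neg_pow (x * y)]
  ring
end

section
/- Let N(z) = z − (az² + bz + c)/(2az + b) be the Newton map of f, and let n be a natural number. If x ∈ ℂ satisfies 2a·N^[m](x) + b ≠ 0 for every m < n, and (x − r₂)^(2^n) ≠ (x − r₁)^(2^n), then N^[n](x) = (r₁·(x − r₂)^(2^n) − r₂·(x − r₁)^(2^n)) / ((x − r₂)^(2^n) − (x − r₁)^(2^n)). -/
/-- One Newton step for a split quadratic squares the distance to a root,
up to a factor that does not depend on which root is chosen. -/
theorem newton_step_sub_root {K : Type*} [Field K] {a r s z : K}
    (hz : 2 * a * z - a * (r + s) ≠ 0) :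
    z - a * (z - r) * (z - s) / (2 * a * z - a * (r + s)) - r =
      a * (z - r) ^ 2 / (2 * a * z - a * (r + s)) := by
  rw [sub_right_comm, eq_div_iff hz, sub_mul, div_mul_cancel₀ _ hz]
  ring

/-- Cross-multiplied form of the conjugacy of Newton's map with squaring. -/
theorem newton_iterate_cross_mul {K : Type*} [Field K] {a r s : K} {N : K → K}
    (hN : ∀ z, N z = z - a * (z - r) * (z - s) / (2 * a * z - a * (r + s)))
    (n : ℕ) (x : K) (hx : ∀ m < n, 2 * a * N^[m] x - a * (r + s) ≠ 0) :
    (N^[n] x - r) * (x - s) ^ (2 ^ n) = (N^[n] x - s) * (x - r) ^ (2 ^ n) := by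
  induction n with
  | zero => simp [mul_comm]
  | succ n ih =>
    have h := ih fun m hm => hx m (hm.trans n.lt_succ_self)
    have hd := hx n n.lt_succ_self
    rw [Function.iterate_succ_apply', pow_succ 2 n, pow_mul, pow_mul]
    generalize N^[n] x = y at h hd ⊢
    have hr : N y - r = a * (y - r) ^ 2 / (2 * a * y - a * (r + s)) := by
      rw [hN, newton_step_sub_root hd]
    have hs : N y - s = a * (y - s) ^ 2 / (2 * a * y - a * (r + s)) := by
      rw [add_comm r s] at hd
      rw [hN, mul_right_comm, add_comm r s, newton_step_sub_root hd]
    rw [hr, hs, div_mul_eq_mul_div, div_mul_eq_mul_div, mul_assoc a, mul_assoc a,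
      ← mul_pow, ← mul_pow, h]

/-- Closed form for the `n`-fold Newton iterate of a quadratic. -/
theorem newton_iterate_closed_form
    (a b c r₁ r₂ : ℂ) (ha : a ≠ 0) (hdisc : b ^ 2 - 4 * a * c ≠ 0)
    (hroots : ∀ X : ℂ, a * X ^ 2 + b * X + c = a * (X - r₁) * (X - r₂))
    (hr : r₁ ≠ r₂)
    (N : ℂ → ℂ)
    (hN : ∀ z : ℂ, N z = z - (a * z ^ 2 + b * z + c) / (2 * a * z + b))
    (n : ℕ) (x : ℂ)
    (hx : ∀ m : ℕ, m < n → 2 * a * (N^[m] x) + b ≠ 0)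
    (hne : (x - r₂) ^ (2 ^ n) ≠ (x - r₁) ^ (2 ^ n)) :
    N^[n] x =
      (r₁ * (x - r₂) ^ (2 ^ n) - r₂ * (x - r₁) ^ (2 ^ n)) /
        ((x - r₂) ^ (2 ^ n) - (x - r₁) ^ (2 ^ n)) := by
  have hb : b = -(a * (r₁ + r₂)) := by
    linear_combination (hroots 1 - hroots (-1)) / 2
  have hN' : ∀ z, N z = z - a * (z - r₁) * (z - r₂) / (2 * a * z - a * (r₁ + r₂)) := by
    intro z
    rw [hN, hroots, hb, ← sub_eq_add_neg]
  have h := newton_iterate_cross_mul hN' n x fun m hm => by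
    have := hx m hm
    rwa [hb, ← sub_eq_add_neg] at this
  rw [eq_div_iff (sub_ne_zero.2 hne)]
  linear_combination h
end
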